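/- For every μ ∈ (0,1] there exists a sequence of positive stepsizes (α_t)_{t≥1} (depending only on μ, not on the stopping time) and universal constants C, C′ > 0 independent of μ such that: for every dimension d, every differentiable f: ℝ^d → ℝ that is μ-strongly convex with 1-Lipschitz gradient and minimizer x*, every initialization x_1, and the gradient descent iterates x_{t+1} = x_t − α_t ∇f(x_t), one has f(x_T) − f(x*) ≤ C′·exp(−C·T·μ^ς)·‖x_1 − x*‖² for every integer T ≥ 1, where ς = (1 + log₂(1+√2))/(2·log₂(1+√2)) < 0.893. -/

import Mathlib

open Finset
open scoped RealInnerProductSpace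

noncomputable section

/-- Gradient-descent trajectory along a finite list of stepsizes. -/
def gdIter {E : Type*} [AddCommGroup E] [SMul ℝ E] (g : E → E) : E → List ℝ → E
  | x, [] => x
  | x, a :: L => gdIter g (x - a • g x) L

/-- A finite stepsize schedule (of positive reals) is primitive if the key
gradient-descent inequality holds for every smooth convex problem instance. -/
def IsPrimitive (L : List ℝ) : Prop :=
  (∀ a ∈ L, (0:ℝ) < a) ∧
  ∀ (d : ℕ) (f : EuclideanSpace ℝ (Fin d) → ℝ)
    (g : EuclideanSpace ℝ (Fin d) → EuclideanSpace ℝ (Fin d)),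
    ConvexOn ℝ Set.univ f →
    (∀ y, HasGradientAt f (g y) y) →
    LipschitzWith 1 g →
    ∀ xstar : EuclideanSpace ℝ (Fin d), IsMinOn f Set.univ xstar →
    ∀ x1 : EuclideanSpace ℝ (Fin d),
      L.sum * (f (gdIter g x1 L) - f xstar)
        + (L.sum * (L.sum + 1) / 2) * ‖g (gdIter g x1 L)‖ ^ 2
        + 2⁻¹ * ‖gdIter g x1 L - xstar‖ ^ 2
      ≤ 2⁻¹ * ‖x1 - xstar‖ ^ 2
        + ∑ i : Fin L.length,
            L.get i *
              (f (gdIter g x1 (L.take i.1)) - f xstar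
                - ⟪g (gdIter g x1 (L.take i.1)), gdIter g x1 (L.take i.1) - xstar⟫
                + 2⁻¹ * ‖g (gdIter g x1 (L.take i.1))‖ ^ 2)

/-- The join-stepsize function. -/
def phi (x y : ℝ) : ℝ :=
  (-(x + y) + Real.sqrt ((x + y + 2) ^ 2 + 4 * (x + 1) * (y + 1))) / 2

/-- Concatenation of two stepsize schedules with the join stepsize in between. -/
def concatSched (s r : List ℝ) : List ℝ := s ++ phi s.sum r.sum :: r

/-- The silver stepsize schedules. -/
def silver : ℕ → List ℝ
  | 0 => []
  | i + 1 => concatSched (silver i) (silver i)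

/-- Recursive concatenation of a sequence of schedules. -/
def concatAll (s : ℕ → List ℝ) : ℕ → List ℝ
  | 0 => []
  | i + 1 => concatSched (concatAll s i) (s (i + 1))

/-- The number of copies of the `j`-th silver schedule. -/
def kSeq (c : ℝ) (j : ℕ) : ℕ := ⌊2 * (2:ℝ) ^ (c * j)⌋₊

def MSeq (c : ℝ) (j : ℕ) : ℕ := ∑ j' ∈ Finset.Icc 1 j, kSeq c j'

/-- The block index `j` of `i`, i.e. the `j` with `M_{j-1} < i ≤ M_j`. -/
def blockIdx (c : ℝ) (i : ℕ) : ℕ := sInf {j | i ≤ MSeq c j}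

/-- The partially concatenated schedules `ŝ_i`. -/
def shatSched (c : ℝ) : ℕ → List ℝ := concatAll fun i => silver (blockIdx c i)

/-- The `t`-th entry (1-indexed) of the infinite limiting schedule `ŝ`. -/
def shatEntry (c : ℝ) (t : ℕ) : ℝ := (shatSched c t).getD (t - 1) 0

/-- The interpolation inequality characterizing convex functions with `1`-Lipschitz gradient. -/
def SmoothConvexIneq {E : Type*} [NormedAddCommGroup E] [InnerProductSpace ℝ E]
    (f : E → ℝ) (g : E → E) : Prop :=
  ∀ x y, f y + ⟪g y, x - y⟫ + 2⁻¹ * ‖g x - g y‖ ^ 2 ≤ f x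

/-- The weighted slack of the interpolation inequalities towards a reference point `z`
with value `c`, accumulated along a gradient descent trajectory. -/
def slackSum {E : Type*} [NormedAddCommGroup E] [InnerProductSpace ℝ E]
    (f : E → ℝ) (g : E → E) (z : E) (c : ℝ) : E → List ℝ → ℝ
  | _, [] => 0
  | x, a :: L =>
      a * (f x - c - ⟪g x, x - z⟫ + 2⁻¹ * ‖g x‖ ^ 2) + slackSum f g z c (x - a • g x) L

/-- The inequality defining primitive schedules, for a fixed objective
and an arbitrary reference point. -/
def PrimitiveIneq {E : Type*} [NormedAddCommGroup E] [InnerProductSpace ℝ E]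
    (f : E → ℝ) (g : E → E) (L : List ℝ) : Prop :=
  ∀ x z c,
    L.sum * (f (gdIter g x L) - c)
      + (L.sum * (L.sum + 1) / 2) * ‖g (gdIter g x L)‖ ^ 2
      + 2⁻¹ * ‖gdIter g x L - z‖ ^ 2
    ≤ 2⁻¹ * ‖x - z‖ ^ 2 + slackSum f g z c x L

section Trajectory

variable {E : Type*} [NormedAddCommGroup E] [InnerProductSpace ℝ E] {f : E → ℝ} {g : E → E}

lemma gdIter_append (g : E → E) (x : E) (L M : List ℝ) :
    gdIter g x (L ++ M) = gdIter g (gdIter g x L) M := by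
  induction L generalizing x with
  | nil => rfl
  | cons a L ih => exact ih _

lemma slackSum_append (f : E → ℝ) (g : E → E) (z : E) (c : ℝ) (x : E) (L M : List ℝ) :
    slackSum f g z c x (L ++ M) =
      slackSum f g z c x L + slackSum f g z c (gdIter g x L) M := by
  induction L generalizing x with
  | nil => simp [slackSum, gdIter]
  | cons a L ih => simp [slackSum, gdIter, ih, add_assoc]

lemma slackSum_nonpos {z : E} {c : ℝ}
    (hz : ∀ x, f x - c - ⟪g x, x - z⟫ + 2⁻¹ * ‖g x‖ ^ 2 ≤ 0)
    {L : List ℝ} (hL : ∀ a ∈ L, 0 < a) (x : E) : slackSum f g z c x L ≤ 0 := by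
  induction L generalizing x with
  | nil => exact le_rfl
  | cons a L ih =>
    have h1 := mul_nonpos_of_nonneg_of_nonpos (hL a (by simp)).le (hz x)
    have h2 := ih (fun b hb => hL b (by simp [hb])) (x - a • g x)
    simp only [slackSum]
    linarith

/-- A gradient step from `u` yields an admissible reference point. -/
lemma SmoothConvexIneq.slack_nonpos (h : SmoothConvexIneq f g) (u x : E) :
    f x - (f u - 2⁻¹ * ‖g u‖ ^ 2) - ⟪g x, x - (u - g u)⟫ + 2⁻¹ * ‖g x‖ ^ 2 ≤ 0 := by
  have h1 := h u x
  rw [norm_sub_sq_real, real_inner_comm] at h1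
  have h2 : x - (u - g u) = g u - (u - x) := by abel
  rw [h2, inner_sub_right]
  linarith [real_inner_comm (g u) (g x), real_inner_comm (g x) (u - x)]

end Trajectory

section JoinStep

variable {x y : ℝ}

lemma phi_relation (hx : 0 ≤ x) (hy : 0 ≤ y) :
    (phi x y - 1) * (x + y + 1 + phi x y) = (x + 1) * (y + 1) := by
  have h := Real.sq_sqrt (show 0 ≤ (x + y + 2) ^ 2 + 4 * (x + 1) * (y + 1) by positivity)
  unfold phi
  linear_combination h / 4

lemma one_lt_phi (hx : 0 ≤ x) (hy : 0 ≤ y) : 1 < phi x y := by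
  have h : x + y + 2 < Real.sqrt ((x + y + 2) ^ 2 + 4 * (x + 1) * (y + 1)) := by
    apply Real.lt_sqrt_of_sq_lt
    have : 0 < (x + 1) * (y + 1) := by positivity
    linarith
  unfold phi
  linarith

lemma phi_lt_right (hx : 0 ≤ x) (hy : 0 ≤ y) : phi x y < y + 2 := by
  have h1 := phi_relation hx hy
  have h2 := one_lt_phi hx hy
  by_contra! h
  nlinarith [mul_nonneg hx hy]

lemma phi_self (hx : 0 ≤ x) : phi x x = 1 + (Real.sqrt 2 - 1) * (x + 1) := by
  have h : (x + x + 2) ^ 2 + 4 * (x + 1) * (x + 1) = (2 * (x + 1)) ^ 2 * 2 := by ring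
  rw [phi, h, Real.sqrt_mul (sq_nonneg _), Real.sqrt_sq (by positivity)]
  ring

end JoinStep

section Concatenation

variable {E : Type*} [NormedAddCommGroup E] [InnerProductSpace ℝ E] {f : E → ℝ} {g : E → E}

lemma primitiveIneq_nil (f : E → ℝ) (g : E → E) : PrimitiveIneq f g [] := by
  intro x z c
  simp [gdIter, slackSum]

lemma pos_of_mem_concatSched {s r : List ℝ} (hs : ∀ a ∈ s, 0 < a) (hr : ∀ a ∈ r, 0 < a) :
    ∀ a ∈ concatSched s r, 0 < a := by
  intro a ha
  have h := one_lt_phi (List.sum_nonneg fun b hb => (hs b hb).le)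
    (List.sum_nonneg fun b hb => (hr b hb).le)
  simp only [concatSched, List.mem_append, List.mem_cons] at ha
  rcases ha with ha | rfl | ha
  · exact hs a ha
  · linarith
  · exact hr a ha

/-- Joining two primitive schedules by the step `phi` gives a primitive schedule. -/
theorem PrimitiveIneq.concatSched (h : SmoothConvexIneq f g) {s r : List ℝ}
    (hs0 : ∀ a ∈ s, 0 < a) (hr0 : ∀ a ∈ r, 0 < a)
    (hs : PrimitiveIneq f g s) (hr : PrimitiveIneq f g r) :
    PrimitiveIneq f g (concatSched s r) := by
  intro x₁ z c
  have hx : 0 ≤ s.sum := List.sum_nonneg fun b hb => (hs0 b hb).le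
  have hy : 0 ≤ r.sum := List.sum_nonneg fun b hb => (hr0 b hb).le
  have hφ := phi_relation hx hy
  have hφ1 := one_lt_phi hx hy
  have hφy := phi_lt_right hx hy
  have hS : (_root_.concatSched s r).sum = s.sum + phi s.sum r.sum + r.sum := by
    simp [_root_.concatSched, add_assoc]
  rw [hS, _root_.concatSched, gdIter_append, slackSum_append]
  simp only [gdIter, slackSum]
  have h1 := hs x₁ z c
  set u := gdIter g x₁ s
  set x := s.sum
  set y := r.sum
  set α := phi x y
  have h2 := hr (u - α • g u) z c
  have h3 := hr (u - α • g u) (u - g u) (f u - 2⁻¹ * ‖g u‖ ^ 2)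
  have h3' := slackSum_nonpos (h.slack_nonpos u) hr0 (u - α • g u)
  set w := gdIter g (u - α • g u) r
  have h4 := hr (u - α • g u) (w - g w) (f w - 2⁻¹ * ‖g w‖ ^ 2)
  have h4' := slackSum_nonpos (h.slack_nonpos w) hr0 (u - α • g u)
  have h5 := h u w
  have h6 := h w u
  change y * (f w - (f w - 2⁻¹ * ‖g w‖ ^ 2)) + y * (y + 1) / 2 * ‖g w‖ ^ 2
    + 2⁻¹ * ‖w - (w - g w)‖ ^ 2 ≤ _ at h4
  obtain ⟨e, he⟩ : ∃ e, e = w - u + g u := ⟨_, rfl⟩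
  have e1 : u - α • g u - z = (u - z) - α • g u := by abel
  have e2 : w - (u - g u) = e := by rw [he]; abel
  have e3 : u - α • g u - (u - g u) = (1 - α) • g u := by module
  have e4 : w - (w - g w) = g w := by abel
  have e5 : u - α • g u - (w - g w) = -(e - g w + (α - 1) • g u) := by rw [he]; module
  have e6 : u - w = g u - e := by rw [he]; abel
  have e7 : w - u = e - g u := by rw [he]; abel
  rw [e1, norm_sub_sq_real (u - z), norm_smul, real_inner_smul_right, mul_pow, Real.norm_eq_abs,
    sq_abs] at h2
  rw [e2, e3, norm_smul, mul_pow, Real.norm_eq_abs, sq_abs] at h3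
  rw [e4, e5, norm_neg, norm_add_sq_real, norm_sub_sq_real, norm_smul, real_inner_smul_right,
    inner_sub_left, mul_pow, Real.norm_eq_abs, sq_abs] at h4
  rw [e6, norm_sub_sq_real, inner_sub_right] at h5
  rw [e7, norm_sub_sq_real, inner_sub_right, real_inner_self_eq_norm_sq] at h6
  rw [real_inner_comm (u - z) (g u)]
  rw [real_inner_comm e (g w), real_inner_comm (g u) (g w)] at h5
  rw [real_inner_comm e (g u)] at h6
  rw [show r.sum = y from rfl] at h2 h3
  have hp : 0 ≤ x + α := by linarith
  have hd : 0 < y + 2 - α := by linarith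
  refine le_of_mul_le_mul_left ?_ hd
  have k12 := mul_le_mul_of_nonneg_left (add_le_add h1 h2) hd.le
  have k3 := mul_le_mul_of_nonneg_left (h3.trans (add_le_of_nonpos_right h3')) hp
  have k4 := mul_le_mul_of_nonneg_left (h4.trans (add_le_of_nonpos_right h4')) hp
  have k5 := mul_le_mul_of_nonneg_left h5 hp
  have k6 := mul_le_mul_of_nonneg_left h6 (mul_nonneg hp (sub_nonneg.2 hφ1.le))
  have kG : (x + α) / 2 * ‖g w‖ ^ 2 * ((α - 1) * (x + y + 1 + α))
    = (x + α) / 2 * ‖g w‖ ^ 2 * ((x + 1) * (y + 1)) := by rw [hφ]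
  have kH : (x + α) / 2 * ‖g u‖ ^ 2 * ((α - 1) * (x + y + 1 + α))
    = (x + α) / 2 * ‖g u‖ ^ 2 * ((x + 1) * (y + 1)) := by rw [hφ]
  linarith

end Concatenation

section Gradient

variable {E : Type*} [NormedAddCommGroup E] [InnerProductSpace ℝ E] [CompleteSpace E]
  {f : E → ℝ} {g : E → E}

lemma hasDerivAt_comp_line (hg : ∀ y, HasGradientAt f (g y) y) (x v : E) (t : ℝ) :
    HasDerivAt (fun t : ℝ => f (x + t • v)) ⟪g (x + t • v), v⟫ t := by
  have h1 : HasDerivAt (fun t : ℝ => x + t • v) v t := by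
    simpa using ((hasDerivAt_id t).smul_const v).const_add x
  have h2 := (hg (x + t • v)).hasFDerivAt.comp_hasDerivAt t h1
  rwa [InnerProductSpace.toDual_apply_apply] at h2

/-- The first-order inequality for strongly convex functions. -/
lemma strongConvex_first_order {μ : ℝ} (hg : ∀ y, HasGradientAt f (g y) y)
    (hf : ConvexOn ℝ Set.univ fun y => f y - μ / 2 * ‖y‖ ^ 2) (x y : E) :
    f y + ⟪g y, x - y⟫ + μ / 2 * ‖x - y‖ ^ 2 ≤ f x := by
  have hline := hasDerivAt_comp_line hg y (x - y) 0
  have hsq : HasDerivAt (fun t : ℝ => ‖y + t • (x - y)‖ ^ 2) (2 * ⟪y, x - y⟫) 0 := by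
    have h1 : HasDerivAt (fun t : ℝ => y + t • (x - y)) (x - y) 0 := by
      simpa using ((hasDerivAt_id (0 : ℝ)).smul_const (x - y)).const_add y
    simpa using h1.norm_sq
  have hconv : ConvexOn ℝ Set.univ
      (fun t : ℝ => f (y + t • (x - y)) - μ / 2 * ‖y + t • (x - y)‖ ^ 2) := by
    have h := hf.comp_affineMap (AffineMap.lineMap y x : ℝ →ᵃ[ℝ] E)
    rw [Set.preimage_univ] at h
    refine h.congr fun t _ => ?_
    simp [AffineMap.lineMap_apply, add_comm]
  have h := hconv.le_slope_of_hasDerivAt (Set.mem_univ 0) (Set.mem_univ 1) one_pos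
    (hline.sub (hsq.const_mul (μ / 2)))
  simp only [slope_def_field, zero_smul, add_zero, one_smul, sub_zero, div_one,
    add_sub_cancel] at h
  have hx : ‖x‖ ^ 2 = ‖y‖ ^ 2 + 2 * ⟪y, x - y⟫ + ‖x - y‖ ^ 2 := by
    rw [← norm_add_sq_real, add_sub_cancel]
  rw [hx] at h
  linarith

/-- The quadratic upper bound for functions with `1`-Lipschitz gradient. -/
lemma le_quadratic_of_lipschitz (hg : ∀ y, HasGradientAt f (g y) y) (hL : LipschitzWith 1 g)
    (x v : E) : f (x + v) ≤ f x + ⟪g x, v⟫ + 2⁻¹ * ‖v‖ ^ 2 := by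
  have hd : ∀ t : ℝ, HasDerivAt
      (fun t : ℝ => f (x + t • v) - t * ⟪g x, v⟫ - t ^ 2 * (2⁻¹ * ‖v‖ ^ 2))
      (⟪g (x + t • v), v⟫ - ⟪g x, v⟫ - 2 * t * (2⁻¹ * ‖v‖ ^ 2)) t := by
    intro t
    have h1 := ((hasDerivAt_comp_line hg x v t).sub
      ((hasDerivAt_id t).mul_const ⟪g x, v⟫)).sub
      ((hasDerivAt_pow 2 t).mul_const (2⁻¹ * ‖v‖ ^ 2))
    exact h1.congr_deriv (by simp)
  have hanti := antitoneOn_of_deriv_nonpos (convex_Icc (0 : ℝ) 1)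
    (fun t _ => (hd t).continuousAt.continuousWithinAt)
    (fun t _ => (hd t).differentiableAt.differentiableWithinAt) (by
      intro t ht
      rw [interior_Icc] at ht
      rw [(hd t).deriv, ← inner_sub_left]
      have h1 := real_inner_le_norm (g (x + t • v) - g x) v
      have h2 : ‖g (x + t • v) - g x‖ ≤ t * ‖v‖ := by
        have h3 := hL.norm_sub_le (x + t • v) x
        simpa [norm_smul, abs_of_pos ht.1] using h3
      have h4 := mul_le_mul_of_nonneg_right h2 (norm_nonneg v)
      nlinarith)
  have h := hanti (Set.left_mem_Icc.2 zero_le_one) (Set.right_mem_Icc.2 zero_le_one) zero_le_one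
  simp only [zero_smul, add_zero, one_smul] at h
  linarith

lemma smoothConvexIneq_of_strongConvex {μ : ℝ} (hμ : 0 ≤ μ)
    (hg : ∀ y, HasGradientAt f (g y) y) (hL : LipschitzWith 1 g)
    (hf : ConvexOn ℝ Set.univ fun y => f y - μ / 2 * ‖y‖ ^ 2) : SmoothConvexIneq f g := by
  intro x y
  have h1 := le_quadratic_of_lipschitz hg hL x (-(g x - g y))
  have h2 := strongConvex_first_order hg hf (x + -(g x - g y)) y
  have h3 : 0 ≤ μ / 2 * ‖x + -(g x - g y) - y‖ ^ 2 := by positivity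
  have h4 : x + -(g x - g y) - y = (x - y) - (g x - g y) := by abel
  rw [norm_neg, inner_neg_right] at h1
  rw [h4] at h2 h3
  rw [inner_sub_right] at h2
  have h5 : ⟪g x, g x - g y⟫ - ⟪g y, g x - g y⟫ = ‖g x - g y‖ ^ 2 := by
    rw [← inner_sub_left, real_inner_self_eq_norm_sq]
  linarith

lemma gradient_eq_zero_of_isMinOn (hg : ∀ y, HasGradientAt f (g y) y) {z : E}
    (hz : IsMinOn f Set.univ z) : g z = 0 := by
  have h := (hz.isLocalMin Filter.univ_mem).hasFDerivAt_eq_zero (hg z).hasFDerivAt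
  simpa using h

end Gradient

section Silver

variable {E : Type*} [NormedAddCommGroup E] [InnerProductSpace ℝ E] {f : E → ℝ} {g : E → E}

lemma pos_of_mem_silver (i : ℕ) : ∀ a ∈ silver i, 0 < a := by
  induction i with
  | zero => simp [silver]
  | succ i ih => exact pos_of_mem_concatSched ih ih

lemma silver_length (i : ℕ) : (silver i).length + 1 = 2 ^ i := by
  induction i with
  | zero => simp [silver]
  | succ i ih =>
    simp only [silver, concatSched, List.length_append, List.length_cons]
    rw [pow_succ]
    omega

lemma silver_sum_nonneg (i : ℕ) : 0 ≤ (silver i).sum :=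
  List.sum_nonneg fun a ha => (pos_of_mem_silver i a ha).le

lemma silver_sum (i : ℕ) : (silver i).sum + 1 = (1 + Real.sqrt 2) ^ i := by
  induction i with
  | zero => simp [silver]
  | succ i ih =>
    simp only [silver, concatSched, List.sum_append, List.sum_cons]
    rw [phi_self (silver_sum_nonneg i), pow_succ, ← ih]
    ring

lemma primitiveIneq_silver (h : SmoothConvexIneq f g) (i : ℕ) :
    PrimitiveIneq f g (silver i) := by
  induction i with
  | zero => exact primitiveIneq_nil f g
  | succ i ih => exact ih.concatSched h (pos_of_mem_silver i) (pos_of_mem_silver i) ih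

variable {z : E}

/-- A primitive schedule followed by a join step does not increase
the distance to a minimizer. -/
lemma PrimitiveIneq.norm_join_step_le (h : SmoothConvexIneq f g) (hz : g z = 0)
    {s : List ℝ} (hs : PrimitiveIneq f g s) (hs0 : ∀ a ∈ s, 0 < a) {α : ℝ}
    (hα0 : 1 ≤ α) (hα : α ≤ s.sum + 2) (x : E) :
    ‖gdIter g x s - α • g (gdIter g x s) - z‖ ≤ ‖x - z‖ := by
  have hS : 0 ≤ s.sum := List.sum_nonneg fun a ha => (hs0 a ha).le
  have h1 := hs x z (f z)
  have h2 := slackSum_nonpos (by simpa [hz] using h.slack_nonpos (f := f) z) hs0 x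
  set u := gdIter g x s
  have h3 := h u z
  have h4 := h z u
  rw [hz] at h3 h4
  simp only [inner_zero_left, sub_zero, zero_sub, norm_neg] at h3 h4
  have h5 : z - u = -(u - z) := by abel
  have h6 : u - α • g u - z = (u - z) - α • g u := by abel
  rw [h5, inner_neg_right] at h4
  rw [← sq_le_sq₀ (norm_nonneg _) (norm_nonneg _), h6, norm_sub_sq_real (u - z), norm_smul,
    real_inner_smul_right, mul_pow, Real.norm_eq_abs, sq_abs, real_inner_comm (g u)]
  have h7 := mul_le_mul_of_nonneg_left h4 (zero_le_one.trans hα0)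
  have h8 := mul_le_mul_of_nonneg_left h3 (add_nonneg hS (zero_le_one.trans hα0))
  have h9 : 0 ≤ ((s.sum + 1) ^ 2 - (α - 1) ^ 2) * ‖g u‖ ^ 2 := by
    refine mul_nonneg (sub_nonneg.2 (pow_le_pow_left₀ ?_ ?_ 2)) (sq_nonneg _) <;> linarith
  linarith

/-- Along a silver schedule, no iterate is farther from a minimizer than the initial point. -/
lemma norm_gdIter_take_silver_le (h : SmoothConvexIneq f g) (hz : g z = 0) (i n : ℕ) (x : E) :
    ‖gdIter g x ((silver i).take n) - z‖ ≤ ‖x - z‖ := by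
  induction i generalizing n x with
  | zero => simp [silver, gdIter]
  | succ i ih =>
    rw [silver, concatSched]
    rcases le_or_gt n (silver i).length with hn | hn
    · rw [List.take_append_of_le_length hn]
      exact ih n x
    · obtain ⟨m, rfl⟩ := Nat.exists_eq_add_of_lt hn
      have hm : (silver i).length + m + 1 - (silver i).length = m + 1 := by omega
      rw [List.take_append, List.take_of_length_le (by omega), hm, List.take_succ_cons,
        gdIter_append, gdIter]
      have hS := silver_sum_nonneg i
      exact (ih m _).trans ((primitiveIneq_silver h i).norm_join_step_le h hz
        (pos_of_mem_silver i) (one_lt_phi hS hS).le (phi_lt_right hS hS).le x)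

lemma SmoothConvexIneq.sub_le_half_sq (h : SmoothConvexIneq f g) (hz : g z = 0) (x : E) :
    f x - f z ≤ 2⁻¹ * ‖x - z‖ ^ 2 := by
  have h1 := h z x
  rw [hz, zero_sub, norm_neg, ← neg_sub x z, inner_neg_right] at h1
  have h2 := norm_sub_sq_real (x - z) (g x)
  rw [real_inner_comm] at h2
  linarith [sq_nonneg ‖x - z - g x‖]

lemma sum_silver_mul_sub_le (h : SmoothConvexIneq f g) (hz : g z = 0) (i : ℕ) (x : E) :
    (silver i).sum * (f (gdIter g x (silver i)) - f z) ≤ 2⁻¹ * ‖x - z‖ ^ 2 := by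
  have h1 := primitiveIneq_silver h i x z (f z)
  have h2 := slackSum_nonpos (by simpa [hz] using h.slack_nonpos (f := f) z)
    (pos_of_mem_silver i) x
  have hS := silver_sum_nonneg i
  have h3 : 0 ≤ (silver i).sum * ((silver i).sum + 1) / 2 *
    ‖g (gdIter g x (silver i))‖ ^ 2 := by positivity
  have h4 : 0 ≤ 2⁻¹ * ‖gdIter g x (silver i) - z‖ ^ 2 := by positivity
  linarith

end Silver

section Restart

/-- The periodic repetition of a finite schedule, indexed from `1`. -/
def periodicSched (L : List ℝ) (t : ℕ) : ℝ := L.getD ((t - 1) % L.length) 1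

lemma periodicSched_pos {L : List ℝ} (hL : ∀ a ∈ L, 0 < a) (t : ℕ) : 0 < periodicSched L t := by
  unfold periodicSched
  rw [List.getD_eq_getElem?_getD]
  rcases h : L[(t - 1) % L.length]? with _ | a
  · simp
  · exact hL a (List.mem_of_getElem? h)

variable {E : Type*} [NormedAddCommGroup E] [InnerProductSpace ℝ E] {f : E → ℝ} {g : E → E}

lemma periodicSched_iterate {L : List ℝ} {x : ℕ → E}
    (hx : ∀ t : ℕ, 1 ≤ t → x (t + 1) = x t - periodicSched L t • g (x t)) (q r : ℕ)
    (hr : r ≤ L.length) :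
    x (L.length * q + 1 + r) = gdIter g (x (L.length * q + 1)) (L.take r) := by
  induction r with
  | zero => simp [gdIter]
  | succ r ih =>
    have hr' : r < L.length := hr
    have hα : periodicSched L (L.length * q + 1 + r) = L[r] := by
      have h1 : L.length * q + 1 + r - 1 = r + L.length * q := by omega
      rw [periodicSched, h1, Nat.add_mul_mod_self_left, Nat.mod_eq_of_lt hr',
        List.getD_eq_getElem _ _ hr']
    rw [← add_assoc, hx _ (by omega), ih hr'.le, hα, ← List.take_append_getElem hr',
      gdIter_append]
    rfl

/-- Linear convergence of restarted silver schedules. -/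
lemma restarted_silver_bound {μ : ℝ} {z : E} (h : SmoothConvexIneq f g) (hz : g z = 0)
    (hsc : ∀ x, μ / 2 * ‖x - z‖ ^ 2 ≤ f x - f z) {i : ℕ}
    (hi : 2 ≤ μ * (silver i).sum) {x : ℕ → E}
    (hx : ∀ t : ℕ, 1 ≤ t → x (t + 1) = x t - periodicSched (silver i) t • g (x t))
    (q r : ℕ) (hr : r ≤ (silver i).length) :
    f (x ((silver i).length * q + 1 + r)) - f z ≤ 2⁻¹ * (2⁻¹ ^ q * ‖x 1 - z‖ ^ 2) := by
  have hq : ‖x ((silver i).length * q + 1) - z‖ ^ 2 ≤ 2⁻¹ ^ q * ‖x 1 - z‖ ^ 2 := by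
    induction q with
    | zero => simp
    | succ q ih =>
      have h1 := periodicSched_iterate hx q _ le_rfl
      have h2 := sum_silver_mul_sub_le h hz i (x ((silver i).length * q + 1))
      rw [List.take_length] at h1
      rw [← h1] at h2
      have h3 : (silver i).length * (q + 1) + 1
        = (silver i).length * q + 1 + (silver i).length := by ring
      rw [h3, pow_succ (2⁻¹ : ℝ)]
      have h4 := mul_le_mul_of_nonneg_left
        (hsc (x ((silver i).length * q + 1 + (silver i).length))) (silver_sum_nonneg i)
      have h5 := mul_le_mul_of_nonneg_right hi
        (sq_nonneg ‖x ((silver i).length * q + 1 + (silver i).length) - z‖)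
      linarith
  rw [periodicSched_iterate hx q r hr]
  have h1 := norm_gdIter_take_silver_le h hz i r (x ((silver i).length * q + 1))
  have h2 := pow_le_pow_left₀ (norm_nonneg _) h1 2
  linarith [h.sub_le_half_sq hz (gdIter g (x ((silver i).length * q + 1)) ((silver i).take r))]

end Restart

/-- A silver schedule with total stepsize at least `2 / μ` whose length is of the
required order. -/
lemma exists_silver_length_le {μ : ℝ} (hμ : 0 < μ) (hμ1 : μ ≤ 1) :
    ∃ i : ℕ, 2 ≤ μ * (silver i).sum ∧
      (silver i).length * μ ^ ((1 + Real.logb 2 (1 + Real.sqrt 2)) /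
        (2 * Real.logb 2 (1 + Real.sqrt 2))) ≤ 6 := by
  set ρ : ℝ := 1 + Real.sqrt 2 with hρ
  set θ : ℝ := Real.logb 2 ρ with hθ
  have hρ2 : 2 ≤ ρ := by
    have : 1 ≤ Real.sqrt 2 := Real.one_le_sqrt.2 one_le_two
    linarith
  have hθ1 : 1 ≤ θ := by
    rw [hθ, Real.le_logb_iff_rpow_le one_lt_two (by linarith), Real.rpow_one]
    exact hρ2
  have hρθ : ρ ^ θ⁻¹ = 2 := by
    have h1 : (2 : ℝ) ^ θ = ρ := Real.rpow_logb two_pos (by norm_num) (by linarith)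
    rw [← h1, ← Real.rpow_mul two_pos.le, mul_inv_cancel₀ (by linarith), Real.rpow_one]
  obtain ⟨n, hn1, hn2⟩ := exists_nat_pow_near (x := 3 / μ) (y := ρ)
    (by rw [le_div_iff₀ hμ]; linarith) (by linarith)
  refine ⟨n + 1, ?_, ?_⟩
  · have h1 : (silver (n + 1)).sum = ρ ^ (n + 1) - 1 := eq_sub_of_add_eq (silver_sum (n + 1))
    rw [div_lt_iff₀ hμ] at hn2
    rw [h1]
    linarith
  · have hlen : ((silver (n + 1)).length : ℝ) ≤ 2 * (3 / μ) ^ θ⁻¹ := by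
      have h1 : ((silver (n + 1)).length : ℝ) + 1 = 2 ^ (n + 1) := by
        exact_mod_cast silver_length (n + 1)
      have h2 : (2 : ℝ) ^ n ≤ (3 / μ) ^ θ⁻¹ := by
        rw [← hρθ, ← Real.rpow_natCast, ← Real.rpow_mul (by linarith), mul_comm,
          Real.rpow_mul (by linarith), Real.rpow_natCast]
        exact Real.rpow_le_rpow (by positivity) hn1 (by positivity)
      rw [pow_succ] at h1
      linarith
    have hexp : θ⁻¹ ≤ (1 + θ) / (2 * θ) := by
      rw [le_div_iff₀ (by linarith)]
      field_simp
      linarith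
    have h3 : (3 : ℝ) ^ θ⁻¹ ≤ 3 := by
      calc (3 : ℝ) ^ θ⁻¹ ≤ 3 ^ (1 : ℝ) :=
            Real.rpow_le_rpow_of_exponent_le (by norm_num) (inv_le_one_of_one_le₀ hθ1)
        _ = 3 := Real.rpow_one 3
    calc ((silver (n + 1)).length : ℝ) * μ ^ ((1 + θ) / (2 * θ))
        ≤ 2 * (3 / μ) ^ θ⁻¹ * μ ^ θ⁻¹ :=
          mul_le_mul hlen (Real.rpow_le_rpow_of_exponent_ge hμ hμ1 hexp) (by positivity)
            (by positivity)
      _ = 2 * 3 ^ θ⁻¹ := by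
          rw [mul_assoc, ← Real.mul_rpow (by positivity) hμ.le, div_mul_cancel₀ _ hμ.ne']
      _ ≤ 6 := by linarith

/-- anytime acceleration for `μ`-strongly convex, 1-smooth problems,
with rate `exp(-C·T·μ^ς)` where `ς = (1+log₂(1+√2))/(2·log₂(1+√2))`. -/
theorem anytime_accelerated_gradient_descent_strongly_convex :
    ∃ C C' : ℝ, 0 < C ∧ 0 < C' ∧
      ∀ μ : ℝ, 0 < μ → μ ≤ 1 →
      ∃ α : ℕ → ℝ, (∀ t : ℕ, 1 ≤ t → 0 < α t) ∧
        ∀ (d : ℕ) (f : EuclideanSpace ℝ (Fin d) → ℝ)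
          (g : EuclideanSpace ℝ (Fin d) → EuclideanSpace ℝ (Fin d)),
          (∀ y, HasGradientAt f (g y) y) →
          LipschitzWith 1 g →
          ConvexOn ℝ Set.univ (fun y => f y - μ / 2 * ‖y‖ ^ 2) →
          ∀ xstar : EuclideanSpace ℝ (Fin d), IsMinOn f Set.univ xstar →
          ∀ x : ℕ → EuclideanSpace ℝ (Fin d),
            (∀ t : ℕ, 1 ≤ t → x (t + 1) = x t - α t • g (x t)) →
            ∀ T : ℕ, 1 ≤ T →
              f (x T) - f xstar ≤
                C' * Real.exp (-(C * T *
                    μ ^ ((1 + Real.logb 2 (1 + Real.sqrt 2)) /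
                      (2 * Real.logb 2 (1 + Real.sqrt 2))))) *
                  ‖x 1 - xstar‖ ^ 2 := by
  refine ⟨Real.log 2 / 6, 1, by positivity, one_pos, fun μ hμ hμ1 => ?_⟩
  obtain ⟨i, hi, hlen⟩ := exists_silver_length_le hμ hμ1
  refine ⟨periodicSched (silver i), fun t _ => periodicSched_pos (pos_of_mem_silver i) t, ?_⟩
  intro d f g hg hL hf z hmin x hx T hT
  have h := smoothConvexIneq_of_strongConvex hμ.le hg hL hf
  have hz := gradient_eq_zero_of_isMinOn hg hmin
  have hsc : ∀ y, μ / 2 * ‖y - z‖ ^ 2 ≤ f y - f z := by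
    intro y
    have h1 := strongConvex_first_order hg hf y z
    rw [hz, inner_zero_left] at h1
    linarith
  set N := (silver i).length with hN
  have hN0 : 0 < N := by
    rw [hN, List.length_pos_iff]
    intro h0
    rw [h0] at hi
    norm_num at hi
  have hr := Nat.mod_lt (T - 1) hN0
  have hT' : T = N * ((T - 1) / N) + 1 + (T - 1) % N := by
    have := Nat.div_add_mod (T - 1) N
    omega
  have hTN : T ≤ N * ((T - 1) / N + 1) := by
    rw [mul_add, mul_one]
    omega
  have hb := restarted_silver_bound h hz hsc hi hx ((T - 1) / N) ((T - 1) % N) hr.le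
  rw [← hN, ← hT'] at hb
  refine hb.trans ?_
  rw [← mul_assoc, one_mul]
  refine mul_le_mul_of_nonneg_right ?_ (sq_nonneg _)
  rw [← pow_succ', inv_pow, ← Real.rpow_natCast, ← Real.rpow_neg two_pos.le,
    Real.rpow_def_of_pos two_pos, Real.exp_le_exp]
  set q := (T - 1) / N + 1
  set m := μ ^ ((1 + Real.logb 2 (1 + Real.sqrt 2)) / (2 * Real.logb 2 (1 + Real.sqrt 2)))
  have hm : 0 ≤ m := Real.rpow_nonneg hμ.le _
  have hlog : 0 < Real.log 2 := Real.log_pos one_lt_two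
  have hkey : (T : ℝ) * m ≤ 6 * q := by
    calc (T : ℝ) * m ≤ (N * q : ℝ) * m := mul_le_mul_of_nonneg_right (by exact_mod_cast hTN) hm
      _ = N * m * q := by ring
      _ ≤ 6 * q := mul_le_mul_of_nonneg_right hlen (Nat.cast_nonneg q)
  have := mul_le_mul_of_nonneg_left hkey hlog.le
  linarith
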